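/- arXiv:2112.13487 — 2 statements merged into one kernel-verified Lean document; each statement's English description precedes it below -/
import Mathlib

section
/- Fix an integer A ≥ 1 and γ > 0, let f̄ : Fin A → ℝ, and let π̄ be a maximizer of f̄ over Fin A. Then there exists a unique λ ∈ [1, A] such that ∑_{π ∈ Fin A} 1/(λ + 2γ·(f̄(π̄) − f̄(π))) = 1. Defining the inverse gap weighting distribution p(π) := 1/(λ + 2γ·(f̄(π̄) − f̄(π))) for this λ, one has, for every f : Fin A → ℝ and every maximizer π_f of f over Fin A: ∑_{π ∈ Fin A} p(π) · [ f(π_f) − f(π) − γ·(f(π) − f̄(π))² ] ≤ A/γ. -/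
/-- the inverse gap weighting strategy is well defined (unique
normalizing constant `lam ∈ [1, A]`) and certifies the bound `A/γ` on the
squared-error Decision-Estimation Coefficient for the multi-armed bandit. -/
theorem inverse_gap_weighting_dec_bound (A : ℕ) (hA : 1 ≤ A) (γ : ℝ) (hγ : 0 < γ)
    (fbar : Fin A → ℝ) (pibar : Fin A) (hpibar : ∀ π, fbar π ≤ fbar pibar) :
    (∃! lam : ℝ, lam ∈ Set.Icc (1 : ℝ) (A : ℝ) ∧
        (∑ π : Fin A, 1 / (lam + 2 * γ * (fbar pibar - fbar π))) = 1) ∧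
      ∀ lam : ℝ, lam ∈ Set.Icc (1 : ℝ) (A : ℝ) →
        (∑ π : Fin A, 1 / (lam + 2 * γ * (fbar pibar - fbar π))) = 1 →
        ∀ (f : Fin A → ℝ) (pif : Fin A), (∀ π, f π ≤ f pif) →
          (∑ π : Fin A, (1 / (lam + 2 * γ * (fbar pibar - fbar π))) *
              (f pif - f π - γ * (f π - fbar π) ^ 2)) ≤ (A : ℝ) / γ := by
  have hA' : (1 : ℝ) ≤ A := by exact_mod_cast hA
  have hg : ∀ π, 0 ≤ 2 * γ * (fbar pibar - fbar π) := fun π =>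
    mul_nonneg (by positivity) (sub_nonneg.2 (hpibar π))
  have hD : ∀ lam : ℝ, 1 ≤ lam → ∀ π, 0 < lam + 2 * γ * (fbar pibar - fbar π) := by
    intro lam hl π
    linarith [hg π]
  have hanti : ∀ x y : ℝ, 1 ≤ x → x < y →
      (∑ π : Fin A, 1 / (y + 2 * γ * (fbar pibar - fbar π))) <
      ∑ π : Fin A, 1 / (x + 2 * γ * (fbar pibar - fbar π)) := by
    intro x y hx hxy
    apply Finset.sum_lt_sum_of_nonempty ⟨pibar, Finset.mem_univ _⟩
    intro π _
    exact one_div_lt_one_div_of_lt (hD x hx π) (by linarith)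
  refine ⟨?_, ?_⟩
  · have hcont : ContinuousOn
        (fun lam : ℝ => ∑ π : Fin A, 1 / (lam + 2 * γ * (fbar pibar - fbar π)))
        (Set.Icc 1 (A : ℝ)) := by
      apply continuousOn_finsetSum
      intro π _
      apply ContinuousOn.div continuousOn_const (by fun_prop)
      intro x hx
      exact (hD x hx.1 π).ne'
    have h1 : 1 ≤ ∑ π : Fin A, 1 / ((1 : ℝ) + 2 * γ * (fbar pibar - fbar π)) := by
      have := Finset.single_le_sum (f := fun π : Fin A =>
        1 / ((1 : ℝ) + 2 * γ * (fbar pibar - fbar π)))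
        (fun π _ => (one_div_pos.2 (hD 1 le_rfl π)).le) (Finset.mem_univ pibar)
      simpa using this
    have h2 : ∑ π : Fin A, 1 / ((A : ℝ) + 2 * γ * (fbar pibar - fbar π)) ≤ 1 := by
      calc _ ≤ ∑ π : Fin A, 1 / (A : ℝ) := by
            apply Finset.sum_le_sum
            intro π _
            exact one_div_le_one_div_of_le (by linarith) (by linarith [hg π])
        _ = 1 := by
            have : (A : ℝ) ≠ 0 := by linarith
            simp [this]
    obtain ⟨lam, hl, hs⟩ := intermediate_value_Icc' hA' hcont ⟨h2, h1⟩
    refine ⟨lam, ⟨hl, hs⟩, ?_⟩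
    rintro y ⟨hy, hys⟩
    simp only at hs
    rcases lt_trichotomy y lam with h | h | h
    · have := hanti y lam hy.1 h
      linarith
    · exact h
    · have := hanti lam y hl.1 h
      linarith
  · intro lam hl hs f pif _
    set p : Fin A → ℝ := fun π => 1 / (lam + 2 * γ * (fbar pibar - fbar π)) with hp
    have hp0 : ∀ π, 0 < p π := fun π => one_div_pos.2 (hD lam hl.1 π)
    have hpD : ∀ π, p π * (lam + 2 * γ * (fbar pibar - fbar π)) = 1 := fun π =>
      one_div_mul_cancel (hD lam hl.1 π).ne'
    have hs' : ∑ π, p π = 1 := hs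
    change ∑ π, p π * (f pif - f π - γ * (f π - fbar π) ^ 2) ≤ (A : ℝ) / γ
    rw [le_div_iff₀ hγ]
    have hq : γ ^ 2 * (p pif * (f pif - fbar pif) ^ 2) ≤
        ∑ π, γ ^ 2 * (p π * (f π - fbar π) ^ 2) :=
      Finset.single_le_sum (f := fun π => γ ^ 2 * (p π * (f π - fbar π) ^ 2))
        (fun π _ => mul_nonneg (sq_nonneg _) (mul_nonneg (hp0 π).le (sq_nonneg _)))
        (Finset.mem_univ pif)
    have hpt : ∀ π, p π * (f pif - f π - γ * (f π - fbar π) ^ 2) * γ ≤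
        p π * (γ * (f pif - fbar pibar) + 1 / 2 - lam / 2) + 1 / 2
          - 1 / 2 * (γ ^ 2 * (p π * (f π - fbar π) ^ 2)) := by
      intro π
      have h1 := hpD π
      have h2 := mul_nonneg (hp0 π).le (sq_nonneg (γ * (f π - fbar π) + 1))
      nlinarith
    have hsum := Finset.sum_le_sum (fun π (_ : π ∈ Finset.univ) => hpt π)
    rw [Finset.sum_sub_distrib, Finset.sum_add_distrib, ← Finset.sum_mul, ← Finset.sum_mul, hs',
      ← Finset.mul_sum] at hsum
    simp only [Finset.sum_const, Finset.card_univ, Fintype.card_fin, nsmul_eq_mul] at hsum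
    have hfin : γ * (f pif - fbar pif) - 1 / 2 * (γ ^ 2 * (p pif * (f pif - fbar pif) ^ 2)) ≤
        (lam + 2 * γ * (fbar pibar - fbar pif)) / 2 := by
      have h1 := hpD pif
      set D := lam + 2 * γ * (fbar pibar - fbar pif)
      have h2 := mul_nonneg (hp0 pif).le (sq_nonneg (γ * (f pif - fbar pif) - D))
      have h3 : p pif * (γ * (f pif - fbar pif) - D) ^ 2 =
          γ ^ 2 * (p pif * (f pif - fbar pif) ^ 2) - 2 * γ * (f pif - fbar pif) * (p pif * D)
            + D * (p pif * D) := by ring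
      rw [h3, h1] at h2
      linarith
    linarith
end

section
/- Let (𝒳₁, 𝔉₁), …, (𝒳ₙ, 𝔉ₙ) be measurable spaces, and for each i = 1,…,n let Pⁱ and Qⁱ be Markov kernels from 𝒳₁ × ⋯ × 𝒳_{i−1} to 𝒳ᵢ (for i = 1 these are probability measures on 𝒳₁), such that the maps x_{1:i−1} ↦ D_H²(Pⁱ(·|x_{1:i−1}), Qⁱ(·|x_{1:i−1})) are measurable. Let P and Q be the laws of (X₁,…,Xₙ) obtained by successively composing these kernels, i.e. Xᵢ ∼ Pⁱ(·|X_{1:i−1}) under P and Xᵢ ∼ Qⁱ(·|X_{1:i−1}) under Q. Then: (i) if n ≥ 2, D_H²(P, Q) ≤ 100·(log n)·E_P[ ∑_{i=1}^n D_H²(Pⁱ(·|X_{1:i−1}), Qⁱ(·|X_{1:i−1})) ]; and (ii) if there exists V ≥ e such that Pⁱ(A | x_{1:i−1}) ≤ V·Qⁱ(A | x_{1:i−1}) for every i, every history x_{1:i−1}, and every measurable A ⊆ 𝒳ᵢ, then D_H²(P, Q) ≤ 3·(log V)·E_P[ ∑_{i=1}^n D_H²(Pⁱ(·|X_{1:i−1}),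 Qⁱ(·|X_{1:i−1})) ]. -/
open MeasureTheory ProbabilityTheory

/-- Squared Hellinger distance `D_H²(P,Q) = ∫ (√(dP/dν) − √(dQ/dν))² dν`
computed with the dominating measure `ν = P + Q`. -/
noncomputable def sqHellinger {α : Type*} [MeasurableSpace α] (P Q : Measure α) : ℝ :=
  ∫ x, (Real.sqrt ((P.rnDeriv (P + Q)) x).toReal
      - Real.sqrt ((Q.rnDeriv (P + Q)) x).toReal) ^ 2 ∂(P + Q)

/-- Restriction of a trajectory `x ∈ ∏_{j<n} 𝒳 j` to its first `k` coordinates. -/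
def resFun (𝒳 : ℕ → Type*) {n : ℕ} (k : ℕ) (hk : k ≤ n)
    (x : ∀ j : Fin n, 𝒳 j) (j : Fin k) : 𝒳 j :=
  x ⟨j.1, lt_of_lt_of_le j.2 hk⟩

/-- Appending a new coordinate to a history: `(x_{1:k}, x_{k+1}) ↦ x_{1:k+1}`. -/
def snocFun (𝒳 : ℕ → Type*) (k : ℕ) (q : (∀ j : Fin k, 𝒳 j) × 𝒳 k)
    (j : Fin (k + 1)) : 𝒳 j :=
  if h : (j : ℕ) < k then q.1 ⟨j, h⟩
  else cast (congrArg 𝒳 (Nat.le_antisymm (Nat.lt_succ_iff.mp j.isLt) (Nat.not_lt.mp h))).symm q.2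


theorem hx_exists_density {α : Type*} [MeasurableSpace α] (P ν : Measure α) [IsFiniteMeasure P]
    [IsFiniteMeasure ν] (h : P ≤ ν) :
    ∃ a : α → ℝ, Measurable a ∧ (∀ x, 0 ≤ a x) ∧ (∀ x, a x ≤ 1) ∧
      P = ν.withDensity (fun x => ENNReal.ofReal (a x)) := by
  refine ⟨fun x => min (P.rnDeriv ν x).toReal 1, ?_, ?_, ?_, ?_⟩
  · exact ((Measure.measurable_rnDeriv _ _).ennreal_toReal).min measurable_const
  · intro x; positivity
  · intro x; exact min_le_right _ _
  · conv_lhs => rw [← Measure.withDensity_rnDeriv_eq P ν (Measure.absolutelyContinuous_of_le h)]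
    apply withDensity_congr_ae
    filter_upwards [Measure.rnDeriv_le_one_of_le h] with x hx
    have hx' : P.rnDeriv ν x ≤ 1 := hx
    have h1 : (P.rnDeriv ν x).toReal ≤ 1 := by
      simpa using ENNReal.toReal_mono ENNReal.one_ne_top hx'
    rw [min_eq_left h1, ENNReal.ofReal_toReal (ne_top_of_le_ne_top ENNReal.one_ne_top hx')]

theorem hx_integral_wd {α : Type*} [MeasurableSpace α] (ν : Measure α) (a φ : α → ℝ)
    (ha : Measurable a) (ha0 : ∀ x, 0 ≤ a x) :
    ∫ x, φ x ∂(ν.withDensity (fun x => ENNReal.ofReal (a x))) = ∫ x, a x * φ x ∂ν := by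
  rw [integral_withDensity_eq_integral_toReal_smul ha.ennreal_ofReal (by simp)]
  simp [ENNReal.toReal_ofReal, ha0]

theorem hx_integrable_wd {α : Type*} [MeasurableSpace α] (ν : Measure α) (a φ : α → ℝ)
    (ha : Measurable a) (ha0 : ∀ x, 0 ≤ a x) :
    Integrable φ (ν.withDensity (fun x => ENNReal.ofReal (a x))) ↔
      Integrable (fun x => a x * φ x) ν := by
  rw [integrable_withDensity_iff_integrable_smul' ha.ennreal_ofReal (by simp)]
  simp [ENNReal.toReal_ofReal, ha0]

/-- The definition does not depend on the dominating measure. -/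
theorem hx_sqH_eq {α : Type*} [MeasurableSpace α] (ν : Measure α)
    (a b : α → ℝ) (ha : Measurable a) (hb : Measurable b) (ha0 : ∀ x, 0 ≤ a x)
    (hb0 : ∀ x, 0 ≤ b x) (hai : Integrable a ν) (hbi : Integrable b ν) (P Q : Measure α)
    (hP : P = ν.withDensity (fun x => ENNReal.ofReal (a x)))
    (hQ : Q = ν.withDensity (fun x => ENNReal.ofReal (b x))) :
    sqHellinger P Q = ∫ x, (Real.sqrt (a x) - Real.sqrt (b x)) ^ 2 ∂ν := by
  have : IsFiniteMeasure P := by rw [hP]; exact isFiniteMeasure_withDensity_ofReal hai.2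
  have : IsFiniteMeasure Q := by rw [hQ]; exact isFiniteMeasure_withDensity_ofReal hbi.2
  have hS : P + Q = ν.withDensity (fun x => ENNReal.ofReal (a x + b x)) := by
    rw [hP, hQ, ← withDensity_add_left ha.ennreal_ofReal]
    congr 1; ext x; simp [ENNReal.ofReal_add (ha0 x) (hb0 x)]
  have hab : Measurable (fun x => a x + b x) := ha.add hb
  have key : ∀ (R : Measure α) (c : α → ℝ), Measurable c → (∀ x, 0 ≤ c x) → Integrable c ν →
      IsFiniteMeasure R → R = ν.withDensity (fun x => ENNReal.ofReal (c x)) → R ≤ P + Q →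
      ∀ᵐ x ∂ν, c x = (a x + b x) * (R.rnDeriv (P + Q) x).toReal := by
    intro R c hc hc0 hci hRf hR hle
    have h1 : R = (P + Q).withDensity (fun x => ENNReal.ofReal (R.rnDeriv (P+Q) x).toReal) := by
      conv_lhs => rw [← Measure.withDensity_rnDeriv_eq R (P+Q) (Measure.absolutelyContinuous_of_le hle)]
      apply withDensity_congr_ae
      filter_upwards [Measure.rnDeriv_lt_top R (P+Q)] with x hx
      rw [ENNReal.ofReal_toReal hx.ne]
    have hm : Measurable (fun x => ENNReal.ofReal (R.rnDeriv (P+Q) x).toReal) :=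
      ((Measure.measurable_rnDeriv _ _).ennreal_toReal).ennreal_ofReal
    have h2 : ν.withDensity (fun x => ENNReal.ofReal (c x)) =
        ν.withDensity ((fun x => ENNReal.ofReal (a x + b x)) *
          (fun x => ENNReal.ofReal (R.rnDeriv (P+Q) x).toReal)) := by
      rw [withDensity_mul _ hab.ennreal_ofReal hm, ← hR]
      conv_lhs => rw [h1]
      conv_rhs => rw [← hS]
    rw [withDensity_eq_iff hc.ennreal_ofReal.aemeasurable
      (hab.ennreal_ofReal.mul hm).aemeasurable] at h2
    · filter_upwards [h2] with x hx
      simp only [Pi.mul_apply] at hx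
      rw [← ENNReal.ofReal_mul (add_nonneg (ha0 x) (hb0 x))] at hx
      exact (ENNReal.ofReal_eq_ofReal_iff (hc0 x)
        (mul_nonneg (add_nonneg (ha0 x) (hb0 x)) ENNReal.toReal_nonneg)).1 hx
    · exact (hci.lintegral_lt_top).ne
  have kP := key P a ha ha0 hai ‹_› hP (Measure.le_add_right le_rfl)
  have kQ := key Q b hb hb0 hbi ‹_› hQ (Measure.le_add_left le_rfl)
  unfold sqHellinger
  conv_lhs => 
    arg 1
    rw [hS]
  rw [hx_integral_wd ν _ _ hab (fun x => add_nonneg (ha0 x) (hb0 x))]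
  apply integral_congr_ae
  filter_upwards [kP, kQ] with x h1 h2
  have h0 := add_nonneg (ha0 x) (hb0 x)
  have h3 : √(a x) = √(a x + b x) * √(P.rnDeriv (P + Q) x).toReal := by
    rw [← Real.sqrt_mul h0, ← h1]
  have h4 : √(b x) = √(a x + b x) * √(Q.rnDeriv (P + Q) x).toReal := by
    rw [← Real.sqrt_mul h0, ← h2]
  rw [h3, h4, ← mul_sub, mul_pow, Real.sq_sqrt h0]

theorem hx_exists_pair {α : Type*} [MeasurableSpace α] (P Q : Measure α)
    [IsProbabilityMeasure P] [IsProbabilityMeasure Q] :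
    ∃ (ν : Measure α) (_ : IsFiniteMeasure ν) (a b : α → ℝ), ν = P + Q ∧
      Measurable a ∧ Measurable b ∧ (∀ x, 0 ≤ a x) ∧
      (∀ x, 0 ≤ b x) ∧ (∀ x, a x ≤ 1) ∧ (∀ x, b x ≤ 1) ∧ Integrable a ν ∧ Integrable b ν ∧
      P = ν.withDensity (fun x => ENNReal.ofReal (a x)) ∧
      Q = ν.withDensity (fun x => ENNReal.ofReal (b x)) ∧ ∫ x, a x ∂ν = 1 ∧ ∫ x, b x ∂ν = 1 ∧
      sqHellinger P Q = ∫ x, (Real.sqrt (a x) - Real.sqrt (b x)) ^ 2 ∂ν := by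
  obtain ⟨a, ha, ha0, ha1, hP⟩ := hx_exists_density P (P + Q) (Measure.le_add_right le_rfl)
  obtain ⟨b, hb, hb0, hb1, hQ⟩ := hx_exists_density Q (P + Q) (Measure.le_add_left le_rfl)
  have hai : Integrable a (P + Q) := Integrable.of_bound ha.aestronglyMeasurable 1
    (by filter_upwards with x; rw [Real.norm_of_nonneg (ha0 x)]; exact ha1 x)
  have hbi : Integrable b (P + Q) := Integrable.of_bound hb.aestronglyMeasurable 1
    (by filter_upwards with x; rw [Real.norm_of_nonneg (hb0 x)]; exact hb1 x)
  refine ⟨P + Q, inferInstance, a, b, rfl, ha, hb, ha0, hb0, ha1, hb1, hai, hbi, hP, hQ, ?_, ?_,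
    hx_sqH_eq _ a b ha hb ha0 hb0 hai hbi P Q hP hQ⟩
  · have := hx_integral_wd (P+Q) a (fun _ => 1) ha ha0
    rw [← hP] at this; simpa using this.symm
  · have := hx_integral_wd (P+Q) b (fun _ => 1) hb hb0
    rw [← hQ] at this; simpa using this.symm

theorem hx_sqrt_sub_sq {a b : ℝ} (ha : 0 ≤ a) (hb : 0 ≤ b) :
    (Real.sqrt a - Real.sqrt b) ^ 2 = a + b - 2 * (Real.sqrt a * Real.sqrt b) := by
  nlinarith [Real.sq_sqrt ha, Real.sq_sqrt hb]

theorem hx_sqrt_sub_sq_le {a b : ℝ} (ha : 0 ≤ a) (hb : 0 ≤ b) :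
    (Real.sqrt a - Real.sqrt b) ^ 2 ≤ a + b := by
  rw [hx_sqrt_sub_sq ha hb]
  nlinarith [Real.sqrt_nonneg a, Real.sqrt_nonneg b, mul_nonneg (Real.sqrt_nonneg a) (Real.sqrt_nonneg b)]

theorem hx_integrable_sq {α : Type*} [MeasurableSpace α] {ν : Measure α} {a b : α → ℝ}
    (ha : Measurable a) (hb : Measurable b) (ha0 : ∀ x, 0 ≤ a x)
    (hb0 : ∀ x, 0 ≤ b x) (hai : Integrable a ν) (hbi : Integrable b ν) :
    Integrable (fun x => (Real.sqrt (a x) - Real.sqrt (b x)) ^ 2) ν := by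
  refine (hai.add hbi).mono' ((ha.sqrt.sub hb.sqrt).pow_const 2).aestronglyMeasurable ?_
  filter_upwards with x
  rw [Real.norm_of_nonneg (sq_nonneg _)]
  exact hx_sqrt_sub_sq_le (ha0 x) (hb0 x)

theorem hx_sqH_nonneg {α : Type*} [MeasurableSpace α] (P Q : Measure α) :
    0 ≤ sqHellinger P Q := integral_nonneg fun _ => sq_nonneg _

theorem hx_sqH_le_two {α : Type*} [MeasurableSpace α] (P Q : Measure α)
    [IsProbabilityMeasure P] [IsProbabilityMeasure Q] : sqHellinger P Q ≤ 2 := by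
  obtain ⟨ν, _, a, b, -, ha, hb, ha0, hb0, ha1, hb1, hai, hbi, hP, hQ, h1, h2, h⟩ :=
    hx_exists_pair P Q
  rw [h]
  calc _ ≤ ∫ x, (a x + b x) ∂ν := integral_mono (hx_integrable_sq ha hb ha0 hb0 hai hbi)
          (hai.add hbi) fun x => hx_sqrt_sub_sq_le (ha0 x) (hb0 x)
    _ = 2 := by rw [integral_add hai hbi, h1, h2]; norm_num

theorem hx_int_bdd {α : Type*} [MeasurableSpace α] (P : Measure α) [IsFiniteMeasure P]
    (φ : α → ℝ) (hφ : Measurable φ) (C : ℝ) (h0 : ∀ x, 0 < φ x) (hC : ∀ x, φ x ≤ C) :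
    Integrable φ P := Integrable.of_bound hφ.aestronglyMeasurable C
    (by filter_upwards with x; rw [Real.norm_of_nonneg (h0 x).le]; exact hC x)

theorem hx_int4 {α : Type*} [MeasurableSpace α] {ν : Measure α} {a b u v : α → ℝ}
    (ha : Integrable a ν) (hb : Integrable b ν) (hu : Integrable u ν) (hv : Integrable v ν) :
    ∫ x, (a x + b x - u x - v x) ∂ν = ∫ x, a x ∂ν + ∫ x, b x ∂ν - ∫ x, u x ∂ν - ∫ x, v x ∂ν := by
  have h1 : Integrable (fun x => a x + b x) ν := ha.add hb
  have h2 : Integrable (fun x => a x + b x - u x) ν := h1.sub hu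
  rw [integral_sub h2 hv, integral_sub h1 hu, integral_add ha hb]

theorem hx_var_lower {α : Type*} [MeasurableSpace α] (P Q : Measure α)
    [IsProbabilityMeasure P] [IsProbabilityMeasure Q] (φ : α → ℝ) (hφ : Measurable φ) (C : ℝ)
    (h0 : ∀ x, 0 < φ x) (hC : ∀ x, φ x ≤ C) (hC' : ∀ x, (φ x)⁻¹ ≤ C) :
    2 - ∫ x, φ x ∂P - ∫ x, (φ x)⁻¹ ∂Q ≤ sqHellinger P Q := by
  have i1 := hx_int_bdd P φ hφ C h0 hC
  have i2 := hx_int_bdd Q (fun x => (φ x)⁻¹) hφ.inv C (fun x => inv_pos.2 (h0 x)) hC'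
  obtain ⟨ν, _, a, b, -, ha, hb, ha0, hb0, ha1, hb1, hai, hbi, hP, hQ, h1, h2, h⟩ :=
    hx_exists_pair P Q
  rw [h]
  rw [hP, hx_integrable_wd ν a φ ha ha0] at i1
  rw [hQ, hx_integrable_wd ν b _ hb hb0] at i2
  rw [hP, hQ, hx_integral_wd ν a _ ha ha0, hx_integral_wd ν b _ hb hb0]
  calc _ = ∫ x, (a x + b x - a x * φ x - b x * (φ x)⁻¹) ∂ν := by
        rw [hx_int4 hai hbi i1 i2, h1, h2]; norm_num
    _ ≤ _ := by
        refine integral_mono (((hai.add hbi).sub i1).sub i2)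
          (hx_integrable_sq ha hb ha0 hb0 hai hbi) fun x => ?_
        simp only
        rw [hx_sqrt_sub_sq (ha0 x) (hb0 x)]
        have h3 := sq_nonneg (Real.sqrt (a x * φ x) - Real.sqrt (b x * (φ x)⁻¹))
        rw [hx_sqrt_sub_sq (mul_nonneg (ha0 x) (h0 x).le)
          (mul_nonneg (hb0 x) (inv_pos.2 (h0 x)).le), Real.sqrt_mul (ha0 x),
          Real.sqrt_mul (hb0 x), Real.sqrt_inv] at h3
        have h4 : √(a x) * √(φ x) * (√(b x) * (√(φ x))⁻¹) = √(a x) * √(b x) := by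
          have := (Real.sqrt_pos.2 (h0 x)).ne'
          field_simp
        rw [h4] at h3
        linarith

theorem hx_aux_ineq {a b δ : ℝ} (ha : 0 ≤ a) (hb : 0 ≤ b) (hδ : 0 < δ) :
    a * (√(b + δ ^ 2) / √(a + δ ^ 2)) ≤ √a * √b + δ * √a := by
  have hpos : 0 < √(a + δ ^ 2) := Real.sqrt_pos.2 (by positivity)
  have h1 : √a ≤ √(a + δ^2) := Real.sqrt_le_sqrt (by nlinarith)
  have h2 : √(b + δ ^ 2) ≤ √b + δ := by
    rw [Real.sqrt_le_left (by positivity)]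
    nlinarith [Real.sq_sqrt hb, Real.sqrt_nonneg b]
  have h3 : a / √(a + δ ^ 2) ≤ √a := by
    rw [div_le_iff₀ hpos]
    nlinarith [Real.mul_self_sqrt ha, Real.sqrt_nonneg a]
  calc _ = a / √(a + δ ^ 2) * √(b + δ ^ 2) := by ring
    _ ≤ √a * (√b + δ) := by gcongr
    _ = _ := by ring

theorem hx_var_upper {α : Type*} [MeasurableSpace α] (P Q : Measure α)
    [IsProbabilityMeasure P] [IsProbabilityMeasure Q] (δ : ℝ) (hδ : 0 < δ) :
    ∃ (φ : α → ℝ) (C : ℝ), Measurable φ ∧ (∀ x, 0 < φ x) ∧ (∀ x, φ x ≤ C) ∧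
      (∀ x, (φ x)⁻¹ ≤ C) ∧
      sqHellinger P Q ≤ 2 - ∫ x, φ x ∂P - ∫ x, (φ x)⁻¹ ∂Q + 4 * δ := by
  obtain ⟨ν, _, a, b, hν, ha, hb, ha0, hb0, ha1, hb1, hai, hbi, hP, hQ, h1, h2, h⟩ :=
    hx_exists_pair P Q
  have bd : ∀ u v : ℝ, 0 ≤ u → 0 ≤ v → v ≤ 1 → √(v + δ^2) / √(u + δ^2) ≤ √(1 + δ^2) / δ := by
    intro u v hu hv hv1
    have : δ ≤ √(u + δ^2) := Real.le_sqrt_of_sq_le (by nlinarith)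
    gcongr
  have hinv : ∀ x, (√(b x + δ^2) / √(a x + δ^2))⁻¹ = √(a x + δ^2) / √(b x + δ^2) :=
    fun x => inv_div _ _
  have hφ : Measurable (fun x => √(b x + δ^2) / √(a x + δ^2)) :=
    (hb.add_const _).sqrt.div (ha.add_const _).sqrt
  have hp : ∀ x, 0 < √(b x + δ^2) / √(a x + δ^2) := fun x =>
    div_pos (Real.sqrt_pos.2 (by have := hb0 x; positivity))
      (Real.sqrt_pos.2 (by have := ha0 x; positivity))
  have hC : ∀ x, √(b x + δ^2) / √(a x + δ^2) ≤ √(1 + δ^2) / δ :=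
    fun x => bd _ _ (ha0 x) (hb0 x) (hb1 x)
  have hC' : ∀ x, (√(b x + δ^2) / √(a x + δ^2))⁻¹ ≤ √(1 + δ^2) / δ := fun x => by
    rw [hinv]; exact bd _ _ (hb0 x) (ha0 x) (ha1 x)
  refine ⟨fun x => √(b x + δ^2) / √(a x + δ^2), √(1 + δ^2) / δ, hφ, hp, hC, hC', ?_⟩
  have i1 := hx_int_bdd P _ hφ _ hp hC
  have i2 := hx_int_bdd Q (fun x => (√(b x + δ^2) / √(a x + δ^2))⁻¹) hφ.inv _
    (fun x => inv_pos.2 (hp x)) hC'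
  have hm : ∫ x, (2 * δ : ℝ) ∂ν = 4 * δ := by
    rw [hν, integral_add_measure (integrable_const _) (integrable_const _)]
    simp; ring
  rw [h, ← hm]
  rw [hP, hx_integrable_wd ν a _ ha ha0] at i1
  rw [hQ, hx_integrable_wd ν b _ hb hb0] at i2
  rw [hP, hQ, hx_integral_wd ν a _ ha ha0, hx_integral_wd ν b _ hb hb0]
  calc _ ≤ ∫ x, (a x + b x - a x * (√(b x + δ^2) / √(a x + δ^2))
            - b x * (√(b x + δ^2) / √(a x + δ^2))⁻¹ + 2 * δ) ∂ν := by
        refine integral_mono (hx_integrable_sq ha hb ha0 hb0 hai hbi)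
          ((((hai.add hbi).sub i1).sub i2).add (integrable_const _)) fun x => ?_
        simp only
        rw [hx_sqrt_sub_sq (ha0 x) (hb0 x), hinv]
        have e1 := hx_aux_ineq (ha0 x) (hb0 x) hδ
        have e2 := hx_aux_ineq (hb0 x) (ha0 x) hδ
        have e3 : √(a x) ≤ 1 := Real.sqrt_le_one.2 (ha1 x)
        have e4 : √(b x) ≤ 1 := Real.sqrt_le_one.2 (hb1 x)
        nlinarith
    _ = _ := by
        have h3 : Integrable (fun x => a x + b x - a x * (√(b x + δ^2) / √(a x + δ^2))
            - b x * (√(b x + δ^2) / √(a x + δ^2))⁻¹) ν := ((hai.add hbi).sub i1).sub i2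
        rw [integral_add h3 (integrable_const _), hx_int4 hai hbi i1 i2, h1, h2]; norm_num

theorem hx_kernel {X Y Z : Type*} [MeasurableSpace X] [MeasurableSpace Y] [MeasurableSpace Z]
    (μ : Measure X) [IsProbabilityMeasure μ] (K L : Kernel X Y) [IsMarkovKernel K]
    [IsMarkovKernel L] (hm : Measurable fun x => sqHellinger (K x) (L x))
    (e : X × Y → Z) (he : Measurable e) :
    sqHellinger ((μ.compProd K).map e) ((μ.compProd L).map e) ≤
      ∫ x, sqHellinger (K x) (L x) ∂μ := by
  have := Measure.isProbabilityMeasure_map (μ := μ.compProd K) he.aemeasurable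
  have := Measure.isProbabilityMeasure_map (μ := μ.compProd L) he.aemeasurable
  apply le_of_forall_pos_le_add
  intro ε hε
  obtain ⟨φ, C, hφ, h0, hC, hC', h⟩ := hx_var_upper ((μ.compProd K).map e) ((μ.compProd L).map e)
    (ε / 4) (by positivity)
  refine h.trans ?_
  have hψ : Measurable (fun z => φ (e z)) := hφ.comp he
  have hpos' : ∀ z, 0 < (φ (e z))⁻¹ := fun z => inv_pos.2 (h0 _)
  have i1 := hx_int_bdd (μ.compProd K) _ hψ C (fun z => h0 _) (fun z => hC _)
  have hψi : Measurable (fun z => (φ (e z))⁻¹) := hψ.inv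
  have hφi : Measurable (fun z => (φ z)⁻¹) := hφ.inv
  have i2 := hx_int_bdd (μ.compProd L) _ hψi C hpos' (fun z => hC' _)
  rw [integral_map he.aemeasurable hφ.aestronglyMeasurable,
    integral_map he.aemeasurable hφi.aestronglyMeasurable]
  have j1 : Integrable (fun x => ∫ y, φ (e (x, y)) ∂K x) μ := by
    simpa [Measure.compProd] using i1.integral_compProd
  have j2 : Integrable (fun x => ∫ y, (φ (e (x, y)))⁻¹ ∂L x) μ := by
    simpa [Measure.compProd] using i2.integral_compProd
  have j3 : Integrable (fun x => 2 - ∫ y, φ (e (x, y)) ∂K x) μ := (integrable_const _).sub j1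
  rw [Measure.integral_compProd i1, Measure.integral_compProd i2]
  have : ∫ x, (2 - ∫ y, φ (e (x, y)) ∂K x - ∫ y, (φ (e (x, y)))⁻¹ ∂L x) ∂μ ≤
      ∫ x, sqHellinger (K x) (L x) ∂μ := by
    refine integral_mono (((integrable_const _).sub j1).sub j2) ?_ fun x => ?_
    · refine Integrable.of_bound hm.aestronglyMeasurable 2 ?_
      filter_upwards with x
      rw [Real.norm_of_nonneg (hx_sqH_nonneg _ _)]; exact hx_sqH_le_two _ _
    · exact hx_var_lower (K x) (L x) (fun y => φ (e (x, y)))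
        (hψ.comp measurable_prodMk_left) C (fun y => h0 _) (fun y => hC _) (fun y => hC' _)
  rw [integral_sub j3 j2, integral_sub (integrable_const _) j1] at this
  simp at this
  linarith

theorem hx_sum_sq {V : Type*} [Fintype V] (v : V → ℝ) (u : ℝ) :
    ∑ x, ∑ y, (v x - v y) ^ 2 ≤ 2 * (Fintype.card V : ℝ) * ∑ x, (u - v x) ^ 2 := by
  have h : ∀ x, ∑ y, (v x - v y) ^ 2 = Fintype.card V * (u - v x) ^ 2 -
      2 * (u - v x) * ∑ y, (u - v y) + ∑ y, (u - v y) ^ 2 := by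
    intro x
    calc _ = ∑ y, ((u - v x) ^ 2 - 2 * (u - v x) * (u - v y) + (u - v y) ^ 2) := by
          refine Finset.sum_congr rfl fun y _ => ?_; ring
      _ = _ := by
          rw [Finset.sum_add_distrib, Finset.sum_sub_distrib, ← Finset.mul_sum]
          simp
  simp_rw [h]
  rw [Finset.sum_add_distrib, Finset.sum_sub_distrib, ← Finset.mul_sum, ← Finset.sum_mul,
    ← Finset.mul_sum]
  simp only [Finset.sum_const, Finset.card_univ, nsmul_eq_mul]
  nlinarith [sq_nonneg (∑ y, (u - v y))]

theorem hx_mem_zm {V : Type*} [AddCommGroup V] (hexp : ∀ x : V, x + x = 0) (d x y : V) :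
    (QuotientAddGroup.mk y : V ⧸ AddSubgroup.zmultiples d) = QuotientAddGroup.mk x ↔
      y = x ∨ y = x + d := by
  have hneg : ∀ x : V, -x = x := fun x => neg_eq_of_add_eq_zero_left (hexp x)
  rw [QuotientAddGroup.eq, AddSubgroup.mem_zmultiples_iff]
  constructor
  · rintro ⟨m, hm⟩
    have h2 : (2 : ℤ) • d = 0 := by rw [two_zsmul, hexp]
    rcases Int.even_or_odd' m with ⟨c, rfl | rfl⟩
    · left
      rw [mul_comm, mul_zsmul, h2, zsmul_zero] at hm
      exact (neg_add_eq_zero.1 hm.symm)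
    · right
      rw [add_zsmul, mul_comm, mul_zsmul, h2, zsmul_zero, one_zsmul, zero_add, hneg] at hm
      rw [hm, add_comm, add_assoc, hexp, add_zero]
  · rintro (rfl | rfl)
    · exact ⟨0, by simp⟩
    · refine ⟨1, ?_⟩
      rw [hneg, one_zsmul, add_comm x d, add_assoc, hexp, add_zero]

theorem hx_comb (f : Finset ℕ → ℝ) (f0 : ∀ A, 0 ≤ f A)
    (hf : ∀ (V : Type) [Fintype V] [DecidableEq V] (A : V → Finset ℕ),
      (∀ x y, x ≠ y → Disjoint (A x) (A y)) →
      ∑ x, ∑ y, (if x = y then 0 else f (A x ∪ A y)) ≤ 2 * (Fintype.card V : ℝ) * ∑ x, f (A x)) :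
    ∀ (k : ℕ) (V : Type) [AddCommGroup V] [Fintype V] [DecidableEq V], (∀ x : V, x + x = 0) →
      Fintype.card V = 2 ^ k → ∀ A : V → Finset ℕ, (∀ x y, x ≠ y → Disjoint (A x) (A y)) →
      f (Finset.univ.biUnion A) ≤ (k + 1) * ∑ x, f (A x) := by
  classical
  intro k
  induction k with
  | zero =>
    intro V _ _ _ hexp hcard A hA
    have : Subsingleton V := Fintype.card_le_one_iff_subsingleton.1 (by rw [hcard]; simp)
    have hu : (Finset.univ : Finset V) = {0} := by
      ext x; simp [Subsingleton.elim x 0]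
    rw [hu]; simp
  | succ k ih =>
    intro V _ _ _ hexp hcard A hA
    have step : ∀ d : V, d ≠ 0 →
        2 * f (Finset.univ.biUnion A) ≤ (k + 1) * ∑ x, f (A x ∪ A (x + d)) := by
      intro d hd
      let H := AddSubgroup.zmultiples d
      let mk : V → V ⧸ H := QuotientAddGroup.mk
      have hmk : ∀ x y, mk y = mk x ↔ y = x ∨ y = x + d := fun x y => hx_mem_zm hexp d x y
      let B : V ⧸ H → Finset ℕ := fun q => (Finset.univ.filter (fun x => mk x = q)).biUnion A
      have hfib : ∀ x, (Finset.univ.filter (fun y => mk y = mk x)) = {x, x + d} := by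
        intro x; ext y; simp [hmk]
      have hB : ∀ x, B (mk x) = A x ∪ A (x + d) := by
        intro x
        simp only [B, hfib]; simp [Finset.biUnion_insert]
      have hcardq : Fintype.card (V ⧸ H) = 2 ^ k := by
        have h1 := AddSubgroup.card_eq_card_quotient_mul_card_addSubgroup H
        have h2 : Nat.card H = 2 := by
          rw [Nat.card_zmultiples]
          exact addOrderOf_eq_prime (by rw [two_nsmul, hexp]) hd
        rw [h2, Nat.card_eq_fintype_card, Nat.card_eq_fintype_card, hcard, pow_succ] at h1
        omega
      have h1 := ih (V ⧸ H) (fun q => by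
        obtain ⟨x, rfl⟩ := QuotientAddGroup.mk_surjective q
        rw [← QuotientAddGroup.mk_add, hexp]; rfl) hcardq B (by
        intro p q hpq
        simp only [B, Finset.disjoint_biUnion_left, Finset.disjoint_biUnion_right,
          Finset.mem_filter, Finset.mem_univ, true_and]
        intro x hx y hy
        apply hA
        rintro rfl
        exact hpq (by rw [← hx, ← hy]))
      have hU : Finset.univ.biUnion B = Finset.univ.biUnion A := by
        ext i; simp [B]
      have hS : ∑ x, f (A x ∪ A (x + d)) = 2 * ∑ q, f (B q) := by
        rw [← Finset.sum_fiberwise Finset.univ mk, Finset.mul_sum]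
        refine Finset.sum_congr rfl fun q _ => ?_
        obtain ⟨x, rfl⟩ := QuotientAddGroup.mk_surjective q
        change ∑ y ∈ Finset.univ.filter (fun y => mk y = mk x), f (A y ∪ A (y + d)) = 
          2 * f (B (mk x))
        rw [Finset.sum_congr rfl (g := fun _ => f (B (mk x)))]
        · rw [Finset.sum_const, hfib, Finset.card_pair]
          · simp
          · simpa using fun h => hd h
        · intro y hy
          rw [← hB y, (Finset.mem_filter.1 hy).2]
      rw [hU] at h1
      rw [hS]; linarith
    have h1 := hf V A hA
    have h2 : ∑ x, ∑ y, (if x = y then 0 else f (A x ∪ A y)) =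
        ∑ d ∈ Finset.univ.erase (0 : V), ∑ x, f (A x ∪ A (x + d)) := by
      calc _ = ∑ x, ∑ d, (if d = 0 then 0 else f (A x ∪ A (x + d))) := by
            refine Finset.sum_congr rfl fun x _ => ?_
            rw [← Equiv.sum_comp (Equiv.addLeft x)]
            refine Finset.sum_congr rfl fun d _ => ?_
            simp
        _ = ∑ d, ∑ x, (if d = 0 then 0 else f (A x ∪ A (x + d))) := Finset.sum_comm
        _ = _ := by
            rw [← Finset.add_sum_erase _ _ (Finset.mem_univ (0 : V))]
            simp only [if_true, Finset.sum_const_zero, zero_add]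
            refine Finset.sum_congr rfl fun d hd => ?_
            simp [Finset.ne_of_mem_erase hd]
    rw [h2] at h1
    have h3 : ∑ d ∈ Finset.univ.erase (0 : V), 2 * f (Finset.univ.biUnion A) ≤
        (k + 1) * ∑ d ∈ Finset.univ.erase (0 : V), ∑ x, f (A x ∪ A (x + d)) := by
      rw [Finset.mul_sum]
      exact Finset.sum_le_sum fun d hd => step d (Finset.ne_of_mem_erase hd)
    rw [Finset.sum_const, Finset.card_erase_of_mem (Finset.mem_univ _), Finset.card_univ, hcard,
      nsmul_eq_mul, Nat.cast_sub Nat.one_le_two_pow] at h3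
    rw [hcard] at h1
    push_cast at h1 h3 ⊢
    have hS0 : 0 ≤ ∑ x, f (A x) := Finset.sum_nonneg fun x _ => f0 _
    set S := ∑ x, f (A x)
    set F := f (Finset.univ.biUnion A)
    set N : ℝ := 2 ^ (k + 1)
    have hN : (k : ℝ) + 2 ≤ N := by
      have : k + 1 < 2 ^ (k + 1) := Nat.lt_two_pow_self
      have : k + 2 ≤ 2 ^ (k + 1) := this
      simp only [N]; exact_mod_cast this
    have hk : (0 : ℝ) ≤ k := Nat.cast_nonneg _
    have h4 : (N - 1) * F ≤ (k + 1) * N * S := by nlinarith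
    have h5 : (k + 1) * N * S ≤ (N - 1) * ((k + 1 + 1) * S) := by
      have : (k + 1) * N ≤ (N - 1) * (k + 1 + 1) := by nlinarith
      nlinarith
    exact le_of_mul_le_mul_left (h4.trans h5) (by linarith)

theorem hx_comb_final (f : Finset ℕ → ℝ) (f0 : ∀ A, 0 ≤ f A) (fe : f ∅ = 0)
    (hf : ∀ (V : Type) [Fintype V] [DecidableEq V] (A : V → Finset ℕ),
      (∀ x y, x ≠ y → Disjoint (A x) (A y)) →
      ∑ x, ∑ y, (if x = y then 0 else f (A x ∪ A y)) ≤ 2 * (Fintype.card V : ℝ) * ∑ x, f (A x))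
    (n : ℕ) (hn : 2 ≤ n) :
    f (Finset.range n) ≤ 100 * Real.log n * ∑ i : Fin n, f {(i : ℕ)} := by
  classical
  have hcard : Fintype.card (Fin (Nat.clog 2 n) → ZMod 2) = 2 ^ (Nat.clog 2 n) := by simp
  have hle : n ≤ 2 ^ Nat.clog 2 n := Nat.le_pow_clog (by norm_num) n
  let e : (Fin (Nat.clog 2 n) → ZMod 2) ≃ Fin (2 ^ Nat.clog 2 n) :=
    Fintype.equivFinOfCardEq hcard
  let A : (Fin (Nat.clog 2 n) → ZMod 2) → Finset ℕ :=
    fun x => if (e x : ℕ) < n then {(e x : ℕ)} else ∅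
  have h := hx_comb f f0 hf (Nat.clog 2 n) (Fin (Nat.clog 2 n) → ZMod 2)
    (fun x => by ext i; exact CharTwo.add_self_eq_zero (x i)) hcard A (by
      intro x y hxy
      have : (e x : ℕ) ≠ e y := fun h => hxy (e.injective (Fin.ext h))
      simp only [A]
      split_ifs <;> simp [this])
  have hU : Finset.univ.biUnion A = Finset.range n := by
    ext i
    simp only [A, Finset.mem_biUnion, Finset.mem_univ, true_and, Finset.mem_range]
    constructor
    · rintro ⟨x, hx⟩
      split_ifs at hx with h
      · simp at hx; omega
      · simp at hx
    · intro hi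
      refine ⟨e.symm ⟨i, by omega⟩, ?_⟩
      simp [hi]
  have hS : ∑ x, f (A x) = ∑ i : Fin n, f {(i : ℕ)} := by
    have h1 : ∑ x, f (A x) = ∑ j : Fin (2 ^ Nat.clog 2 n),
        (if (j : ℕ) < n then f {(j : ℕ)} else 0) := by
      rw [← Equiv.sum_comp e]
      refine Finset.sum_congr rfl fun x _ => ?_
      simp only [A]; split_ifs <;> simp [fe]
    rw [h1, Fin.sum_univ_eq_sum_range (fun j => if j < n then f {j} else 0),
      Fin.sum_univ_eq_sum_range (fun j => f {j})]
    rw [← Finset.sum_subset (Finset.range_subset_range.2 hle)]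
    · exact Finset.sum_congr rfl fun j hj => by simp [Finset.mem_range.1 hj]
    · intro j _ hj; simp at hj; simp [hj]
  rw [hU, hS] at h
  refine h.trans (mul_le_mul_of_nonneg_right ?_ (Finset.sum_nonneg fun _ _ => f0 _))
  have hlog2 := Real.log_two_gt_d9
  have hn' : Real.log 2 ≤ Real.log n := Real.log_le_log (by norm_num) (by exact_mod_cast hn)
  have h2 : 2 ^ (Nat.clog 2 n - 1) ≤ n := (Nat.pow_pred_clog_lt_self (by norm_num) (by omega)).le
  have h3 : ((Nat.clog 2 n - 1 : ℕ) : ℝ) * Real.log 2 ≤ Real.log n := by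
    rw [← Real.log_pow]
    exact Real.log_le_log (by positivity) (by exact_mod_cast h2)
  have h4 : (Nat.clog 2 n : ℝ) ≤ ((Nat.clog 2 n - 1 : ℕ) : ℝ) + 1 := by
    exact_mod_cast (by omega : Nat.clog 2 n ≤ Nat.clog 2 n - 1 + 1)
  have h5 : (0 : ℝ) ≤ ((Nat.clog 2 n - 1 : ℕ) : ℝ) := Nat.cast_nonneg _
  nlinarith

theorem hx_log_ineq {t T : ℝ} (ht : 0 < t) (hT : 1 ≤ T) (htT : t ^ 2 ≤ Real.exp T) :
    2 * t ^ 2 * Real.log t ≤ t ^ 2 - 1 + 3 * T * (t - 1) ^ 2 := by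
  rcases le_or_gt t 1 with h | h
  · have h1 := Real.log_le_sub_one_of_pos ht
    have h2 : 2 * t ^ 2 * Real.log t ≤ 2 * t ^ 2 * (t - 1) := by gcongr
    nlinarith [mul_nonneg (sub_nonneg.2 h) (sq_nonneg (t - 1)),
      mul_nonneg (sub_nonneg.2 hT) (sq_nonneg (t - 1))]
  · have h1 : 2 * Real.log t ≤ T := by
      have := Real.log_le_log (by positivity) htT
      rw [Real.log_exp, Real.log_pow] at this
      exact_mod_cast this
    have h3 : Real.log t ≤ (t ^ 2 - 1) / (2 * t) := by
      have h4 := Real.self_le_sinh_iff.2 (Real.log_nonneg h.le)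
      rw [Real.sinh_log ht] at h4
      refine h4.trans (le_of_eq ?_)
      field_simp
    rw [le_div_iff₀ (by positivity)] at h3
    have h5 : 2 * t ^ 2 * Real.log t ≤ t ^ 2 - 1 + (2 + 2 * Real.log t) * (t - 1) ^ 2 := by
      have : Real.log t * (2 * t) * (2 * t - 1) ≤ (t^2 - 1) * (2 * t - 1) :=
        mul_le_mul_of_nonneg_right h3 (by linarith)
      have h6 : t * (2 * Real.log t * (2 * t - 1)) ≤ t * (t ^ 2 - 1 + 2 * (t-1)^2) := by
        nlinarith [mul_nonneg (sub_nonneg.2 h.le) (sq_nonneg (t - 1))]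
      have := le_of_mul_le_mul_left h6 ht
      nlinarith
    nlinarith [mul_nonneg (sub_nonneg.2 hT) (sq_nonneg (t - 1)),
      mul_nonneg (sub_nonneg.2 h1) (sq_nonneg (t - 1))]

theorem hx_kl_upper {p q T : ℝ} (hp : 0 ≤ p) (hq : 0 ≤ q) (hT : 1 ≤ T) (h : p ≤ Real.exp T * q) :
    p * Real.log (p / q) ≤ p - q + 3 * T * (√p - √q) ^ 2 := by
  rcases hq.eq_or_lt with rfl | hq
  · have : p = 0 := le_antisymm (by simpa using h) hp
    simp [this]
  rcases hp.eq_or_lt with rfl | hp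
  · simp only [zero_mul, zero_sub, Real.sqrt_zero, neg_sq, Real.sq_sqrt hq.le]; nlinarith
  have hsq := Real.sqrt_pos.2 hq
  have hsp := Real.sqrt_pos.2 hp
  have e1 : (√p / √q) ^ 2 = p / q := by rw [div_pow, Real.sq_sqrt hp.le, Real.sq_sqrt hq.le]
  have h1 := hx_log_ineq (t := √p / √q) (by positivity) hT
    (by rw [e1, div_le_iff₀ hq]; exact h)
  have e2 : Real.log (p / q) = 2 * Real.log (√p / √q) := by
    rw [← e1, Real.log_pow]; norm_num
  rw [e1] at h1
  have h2 := mul_le_mul_of_nonneg_left h1 hq.le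
  have e3 : q * (√p / √q - 1) ^ 2 = (√p - √q) ^ 2 := by
    have h9 : q = √q ^ 2 := (Real.sq_sqrt hq.le).symm
    conv_lhs =>
      arg 1
      rw [h9]
    rw [← mul_pow, mul_sub, mul_div_cancel₀ _ hsq.ne', mul_one]
  have e4 : q * (p / q) = p := by field_simp
  rw [e2, ← e3]
  calc p * (2 * Real.log (√p / √q)) = q * (2 * (p / q) * Real.log (√p / √q)) := by
        field_simp
    _ ≤ _ := h2
    _ = _ := by rw [mul_add, mul_sub, e4]; ring

theorem hx_kl_lower {p q : ℝ} (hp : 0 ≤ p) (hq : 0 ≤ q) (h : q = 0 → p = 0) :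
    (√p - √q) ^ 2 ≤ p * Real.log (p / q) + q - p := by
  rcases hq.eq_or_lt with rfl | hq
  · simp [h rfl]
  rcases hp.eq_or_lt with rfl | hp
  · simp [Real.sq_sqrt hq.le]
  have hsq := Real.sqrt_pos.2 hq
  have hsp := Real.sqrt_pos.2 hp
  have e1 : (√q / √p) ^ 2 = q / p := by rw [div_pow, Real.sq_sqrt hp.le, Real.sq_sqrt hq.le]
  have e2 : Real.log (p / q) = - (2 * Real.log (√q / √p)) := by
    rw [← inv_div, Real.log_inv, ← e1, Real.log_pow]; norm_num
  have h1 := Real.log_le_sub_one_of_pos (div_pos hsq hsp)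
  have h2 := mul_le_mul_of_nonneg_left h1 hp.le
  have e3 : p * (√q / √p) = √p * √q := by
    have h9 : p = √p ^ 2 := (Real.sq_sqrt hp.le).symm
    conv_lhs =>
      arg 1
      rw [h9]
    field_simp
  rw [mul_sub, e3] at h2
  rw [hx_sqrt_sub_sq hp.le hq.le, e2]
  linarith

theorem hx_snoc_meas (𝒳 : ℕ → Type*) [∀ i, MeasurableSpace (𝒳 i)] (k : ℕ) :
    Measurable (snocFun 𝒳 k) := by
  rw [measurable_pi_iff]
  intro j
  by_cases h : (j : ℕ) < k
  · have : (fun q => snocFun 𝒳 k q j) = fun q => q.1 ⟨j, h⟩ := by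
      ext q; simp [snocFun, h]
    rw [this]
    exact (measurable_pi_apply (⟨j, h⟩ : Fin k)).comp measurable_fst
  · obtain ⟨j, hj⟩ := j
    have hjk : j = k := by simp at h; omega
    subst hjk
    have : (fun q => snocFun 𝒳 j q ⟨j, hj⟩) = fun q => q.2 := by
      ext q; simp [snocFun]
    rw [this]
    exact measurable_snd

theorem hx_res_meas (𝒳 : ℕ → Type*) [∀ i, MeasurableSpace (𝒳 i)] {n : ℕ} (k : ℕ) (hk : k ≤ n) :
    Measurable (resFun 𝒳 (n := n) k hk) := by
  rw [measurable_pi_iff]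
  intro j
  exact measurable_pi_apply (⟨j.1, lt_of_lt_of_le j.2 hk⟩ : Fin n)

theorem hx_res_snoc (𝒳 : ℕ → Type*) (k : ℕ) (q : (∀ j : Fin k, 𝒳 j) × 𝒳 k) :
    resFun 𝒳 k (Nat.le_succ k) (snocFun 𝒳 k q) = q.1 := by
  funext j
  simp [resFun, snocFun, j.2]

noncomputable def hxS {𝒳 : ℕ → Type*} [∀ i, MeasurableSpace (𝒳 i)] {k : ℕ}
    (κ : Kernel (∀ j : Fin k, 𝒳 j) (𝒳 k)) (μ : Measure (∀ j : Fin k, 𝒳 j)) :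
    Measure (∀ j : Fin (k + 1), 𝒳 j) := (μ.compProd κ).map (snocFun 𝒳 k)

theorem hxS_res {𝒳 : ℕ → Type*} [∀ i, MeasurableSpace (𝒳 i)] {k : ℕ}
    (κ : Kernel (∀ j : Fin k, 𝒳 j) (𝒳 k)) [IsMarkovKernel κ] (μ : Measure (∀ j : Fin k, 𝒳 j))
    [IsFiniteMeasure μ] : (hxS κ μ).map (resFun 𝒳 k (Nat.le_succ k)) = μ := by
  rw [hxS, Measure.map_map (hx_res_meas 𝒳 k _) (hx_snoc_meas 𝒳 k)]
  have : (resFun 𝒳 k (Nat.le_succ k)) ∘ (snocFun 𝒳 k) = Prod.fst := by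
    ext q; simp [hx_res_snoc]
  rw [this]
  exact Measure.fst_compProd μ κ

theorem hxS_fin {𝒳 : ℕ → Type*} [∀ i, MeasurableSpace (𝒳 i)] {k : ℕ}
    (κ : Kernel (∀ j : Fin k, 𝒳 j) (𝒳 k)) [IsMarkovKernel κ] (μ : Measure (∀ j : Fin k, 𝒳 j))
    [IsFiniteMeasure μ] : IsFiniteMeasure (hxS κ μ) := by
  unfold hxS; infer_instance

theorem hxS_prob {𝒳 : ℕ → Type*} [∀ i, MeasurableSpace (𝒳 i)] {k : ℕ}
    (κ : Kernel (∀ j : Fin k, 𝒳 j) (𝒳 k)) [IsMarkovKernel κ] (μ : Measure (∀ j : Fin k, 𝒳 j))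
    [IsProbabilityMeasure μ] : IsProbabilityMeasure (hxS κ μ) :=
  Measure.isProbabilityMeasure_map (hx_snoc_meas 𝒳 k).aemeasurable

theorem hxS_wd {𝒳 : ℕ → Type*} [∀ i, MeasurableSpace (𝒳 i)] {k : ℕ}
    (κ : Kernel (∀ j : Fin k, 𝒳 j) (𝒳 k)) [IsMarkovKernel κ] (μ : Measure (∀ j : Fin k, 𝒳 j))
    [IsFiniteMeasure μ] (g : (∀ j : Fin k, 𝒳 j) → ENNReal) (hg : Measurable g) :
    hxS κ (μ.withDensity g) =
      (hxS κ μ).withDensity (fun x => g (resFun 𝒳 k (Nat.le_succ k) x)) := by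
  have hs := hx_snoc_meas 𝒳 k
  have hr : Measurable (resFun 𝒳 (n := k + 1) k (Nat.le_succ k)) := hx_res_meas 𝒳 k _
  refine Measure.ext_of_lintegral _ fun f hf => ?_
  have hfs : Measurable (fun q => f (snocFun 𝒳 k q)) := hf.comp hs
  have hgr : Measurable (fun x => g (resFun 𝒳 (n := k + 1) k (Nat.le_succ k) x)) := hg.comp hr
  have hgf : Measurable (fun q => ((fun x => g (resFun 𝒳 (n := k + 1) k (Nat.le_succ k) x)) * f)
    (snocFun 𝒳 k q)) := (hgr.mul hf).comp hs
  rw [lintegral_withDensity_eq_lintegral_mul _ hgr hf]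
  unfold hxS
  rw [lintegral_map hf hs, lintegral_map (hgr.mul hf) hs, Measure.lintegral_compProd hfs,
    Measure.lintegral_compProd hgf,
    lintegral_withDensity_eq_lintegral_mul _ hg hfs.lintegral_kernel_prod_right']
  refine lintegral_congr fun x => ?_
  simp only [Pi.mul_apply, hx_res_snoc]
  rw [lintegral_const_mul]
  exact hfs.comp measurable_prodMk_left

noncomputable def hxM {𝒳 : ℕ → Type*} [∀ i, MeasurableSpace (𝒳 i)]
    (K L : (i : ℕ) → Kernel (∀ j : Fin i, 𝒳 j) (𝒳 i)) : (k : ℕ) → Measure (∀ j : Fin k, 𝒳 j)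
  | 0 => Measure.dirac (fun j => j.elim0)
  | k + 1 => hxS (K k) (hxM K L k) + hxS (L k) (hxM K L k)

noncomputable def hxH {𝒳 : ℕ → Type*} [∀ i, MeasurableSpace (𝒳 i)]
    (K L : (i : ℕ) → Kernel (∀ j : Fin i, 𝒳 j) (𝒳 i)) (A : Finset ℕ) :
    (k : ℕ) → Measure (∀ j : Fin k, 𝒳 j)
  | 0 => Measure.dirac (fun j => j.elim0)
  | k + 1 => if k ∈ A then hxS (L k) (hxH K L A k) else hxS (K k) (hxH K L A k)

noncomputable def hxg {𝒳 : ℕ → Type*} (dK dL : (k : ℕ) → (∀ j : Fin (k + 1), 𝒳 j) → ℝ)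
    (A : Finset ℕ) : (k : ℕ) → (∀ j : Fin k, 𝒳 j) → ℝ
  | 0 => fun _ => 1
  | k + 1 => fun x => hxg dK dL A k (resFun 𝒳 k (Nat.le_succ k) x) *
      (if k ∈ A then dL k x else dK k x)

theorem hxM_fin {𝒳 : ℕ → Type*} [∀ i, MeasurableSpace (𝒳 i)]
    (K L : (i : ℕ) → Kernel (∀ j : Fin i, 𝒳 j) (𝒳 i))
    [∀ i, IsMarkovKernel (K i)] [∀ i, IsMarkovKernel (L i)] (k : ℕ) :
    IsFiniteMeasure (hxM K L k) := by
  induction k with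
  | zero => unfold hxM; infer_instance
  | succ k ih =>
    unfold hxM
    have := hxS_fin (K k) (hxM K L k)
    have := hxS_fin (L k) (hxM K L k)
    infer_instance

theorem hxH_prob {𝒳 : ℕ → Type*} [∀ i, MeasurableSpace (𝒳 i)]
    (K L : (i : ℕ) → Kernel (∀ j : Fin i, 𝒳 j) (𝒳 i))
    [∀ i, IsMarkovKernel (K i)] [∀ i, IsMarkovKernel (L i)] (A : Finset ℕ) (k : ℕ) :
    IsProbabilityMeasure (hxH K L A k) := by
  induction k with
  | zero => unfold hxH; infer_instance
  | succ k ih =>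
    unfold hxH
    split_ifs
    · exact hxS_prob _ _
    · exact hxS_prob _ _

theorem hxH_congr {𝒳 : ℕ → Type*} [∀ i, MeasurableSpace (𝒳 i)]
    (K L : (i : ℕ) → Kernel (∀ j : Fin i, 𝒳 j) (𝒳 i)) (A B : Finset ℕ) (k : ℕ)
    (h : ∀ j < k, j ∈ A ↔ j ∈ B) : hxH K L A k = hxH K L B k := by
  induction k with
  | zero => rfl
  | succ k ih =>
    unfold hxH
    rw [ih (fun j hj => h j (by omega))]
    simp only [h k (by omega)]

structure HxD {𝒳 : ℕ → Type*} [∀ i, MeasurableSpace (𝒳 i)]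
    (K L : (i : ℕ) → Kernel (∀ j : Fin i, 𝒳 j) (𝒳 i))
    (dK dL : (k : ℕ) → (∀ j : Fin (k + 1), 𝒳 j) → ℝ) : Prop where
  mK : ∀ k, Measurable (dK k)
  mL : ∀ k, Measurable (dL k)
  K0 : ∀ k x, 0 ≤ dK k x
  L0 : ∀ k x, 0 ≤ dL k x
  K1 : ∀ k x, dK k x ≤ 1
  L1 : ∀ k x, dL k x ≤ 1
  eK : ∀ k, hxS (K k) (hxM K L k) =
    (hxM K L (k + 1)).withDensity (fun x => ENNReal.ofReal (dK k x))
  eL : ∀ k, hxS (L k) (hxM K L k) =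
    (hxM K L (k + 1)).withDensity (fun x => ENNReal.ofReal (dL k x))

theorem hxD_exists {𝒳 : ℕ → Type*} [∀ i, MeasurableSpace (𝒳 i)]
    (K L : (i : ℕ) → Kernel (∀ j : Fin i, 𝒳 j) (𝒳 i))
    [∀ i, IsMarkovKernel (K i)] [∀ i, IsMarkovKernel (L i)] :
    ∃ dK dL : (k : ℕ) → (∀ j : Fin (k + 1), 𝒳 j) → ℝ, HxD K L dK dL := by
  have h1 : ∀ k, ∃ a : (∀ j : Fin (k + 1), 𝒳 j) → ℝ, Measurable a ∧ (∀ x, 0 ≤ a x) ∧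
      (∀ x, a x ≤ 1) ∧ hxS (K k) (hxM K L k) =
        (hxM K L (k + 1)).withDensity (fun x => ENNReal.ofReal (a x)) := by
    intro k
    have := hxM_fin K L k
    have := hxM_fin K L (k + 1)
    have := hxS_fin (K k) (hxM K L k)
    exact hx_exists_density _ _ (Measure.le_add_right le_rfl)
  have h2 : ∀ k, ∃ a : (∀ j : Fin (k + 1), 𝒳 j) → ℝ, Measurable a ∧ (∀ x, 0 ≤ a x) ∧
      (∀ x, a x ≤ 1) ∧ hxS (L k) (hxM K L k) =
        (hxM K L (k + 1)).withDensity (fun x => ENNReal.ofReal (a x)) := by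
    intro k
    have := hxM_fin K L k
    have := hxM_fin K L (k + 1)
    have := hxS_fin (L k) (hxM K L k)
    exact hx_exists_density _ _ (Measure.le_add_left le_rfl)
  choose dK a1 a2 a3 a4 using h1
  choose dL b1 b2 b3 b4 using h2
  exact ⟨dK, dL, a1, b1, a2, b2, a3, b3, a4, b4⟩

section
universe u
variable {𝒳 : ℕ → Type u} [∀ i, MeasurableSpace (𝒳 i)]
    {K L : (i : ℕ) → Kernel (∀ j : Fin i, 𝒳 j) (𝒳 i)}
    [∀ i, IsMarkovKernel (K i)] [∀ i, IsMarkovKernel (L i)]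
    {dK dL : (k : ℕ) → (∀ j : Fin (k + 1), 𝒳 j) → ℝ}

theorem hxg_meas (hd : HxD K L dK dL) (A : Finset ℕ) (k : ℕ) : Measurable (hxg dK dL A k) := by
  induction k with
  | zero => unfold hxg; exact measurable_const
  | succ k ih =>
    unfold hxg
    refine (ih.comp (hx_res_meas 𝒳 k _)).mul ?_
    split_ifs
    · exact hd.mL k
    · exact hd.mK k

theorem hxg_nonneg (hd : HxD K L dK dL) (A : Finset ℕ) (k : ℕ) (x) : 0 ≤ hxg dK dL A k x := by
  induction k with
  | zero => unfold hxg; exact zero_le_one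
  | succ k ih =>
    unfold hxg
    refine mul_nonneg (ih _) ?_
    split_ifs
    · exact hd.L0 k x
    · exact hd.K0 k x

theorem hxg_le_one (hd : HxD K L dK dL) (A : Finset ℕ) (k : ℕ) (x) : hxg dK dL A k x ≤ 1 := by
  induction k with
  | zero => unfold hxg; exact le_rfl
  | succ k ih =>
    unfold hxg
    refine mul_le_one₀ (ih _) ?_ ?_
    · split_ifs
      · exact hd.L0 k x
      · exact hd.K0 k x
    · split_ifs
      · exact hd.L1 k x
      · exact hd.K1 k x

theorem hxg_integrable (hd : HxD K L dK dL) (A : Finset ℕ) (k : ℕ) :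
    Integrable (hxg dK dL A k) (hxM K L k) := by
  have := hxM_fin K L k
  refine Integrable.of_bound (hxg_meas hd A k).aestronglyMeasurable 1 ?_
  filter_upwards with x
  rw [Real.norm_of_nonneg (hxg_nonneg hd A k x)]; exact hxg_le_one hd A k x

theorem hxH_eq (hd : HxD K L dK dL) (A : Finset ℕ) (k : ℕ) :
    hxH K L A k = (hxM K L k).withDensity (fun x => ENNReal.ofReal (hxg dK dL A k x)) := by
  induction k with
  | zero => simp [hxH, hxM, hxg]
  | succ k ih =>
    have := hxM_fin K L k
    have hr : Measurable (resFun 𝒳 (n := k + 1) k (Nat.le_succ k)) := hx_res_meas 𝒳 k _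
    have hm := (hxg_meas hd A k).ennreal_ofReal
    have hm' : Measurable (fun x => ENNReal.ofReal
      (hxg dK dL A k (resFun 𝒳 (n := k + 1) k (Nat.le_succ k) x))) := hm.comp hr
    by_cases h : k ∈ A
    · simp only [hxH, h, if_true, hxg]
      rw [ih, hxS_wd _ _ _ hm, hd.eL, ← withDensity_mul _ (hd.mL k).ennreal_ofReal hm']
      congr 1; ext x
      rw [ENNReal.ofReal_mul (hxg_nonneg hd A k _), Pi.mul_apply, mul_comm]
    · simp only [hxH, h, if_false, hxg]
      rw [ih, hxS_wd _ _ _ hm, hd.eK, ← withDensity_mul _ (hd.mK k).ennreal_ofReal hm']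
      congr 1; ext x
      rw [ENNReal.ofReal_mul (hxg_nonneg hd A k _), Pi.mul_apply, mul_comm]

theorem hxg_int (hd : HxD K L dK dL) (A : Finset ℕ) (k : ℕ) :
    ∫ x, hxg dK dL A k x ∂(hxM K L k) = 1 := by
  have := hxH_prob K L A k
  have h := hx_integral_wd (hxM K L k) _ (fun _ => 1) (hxg_meas hd A k) (hxg_nonneg hd A k)
  rw [← hxH_eq hd] at h
  simpa using h.symm

theorem hx_sqH_H (hd : HxD K L dK dL) (A B : Finset ℕ) (k : ℕ) :
    sqHellinger (hxH K L A k) (hxH K L B k) =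
      ∫ x, (√(hxg dK dL A k x) - √(hxg dK dL B k x)) ^ 2 ∂(hxM K L k) :=
  hx_sqH_eq _ _ _ (hxg_meas hd A k) (hxg_meas hd B k) (hxg_nonneg hd A k) (hxg_nonneg hd B k)
    (hxg_integrable hd A k) (hxg_integrable hd B k) _ _ (hxH_eq hd A k) (hxH_eq hd B k)

theorem hxg_cut (A B : Finset ℕ) (k : ℕ) (x : ∀ j : Fin k, 𝒳 j) (hAB : Disjoint A B) :
    hxg dK dL A k x * hxg dK dL B k x = hxg dK dL ∅ k x * hxg dK dL (A ∪ B) k x := by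
  induction k with
  | zero => simp [hxg]
  | succ k ih =>
    unfold hxg
    have h := ih (resFun 𝒳 k (Nat.le_succ k) x)
    by_cases hA : k ∈ A
    · have hB : k ∉ B := Finset.disjoint_left.1 hAB hA
      simp only [hA, hB, if_true, if_false, Finset.mem_union, true_or, Finset.notMem_empty]
      linear_combination (dL k x * dK k x) * h
    · by_cases hB : k ∈ B
      · simp only [hA, hB, if_true, if_false, Finset.mem_union, or_true, Finset.notMem_empty]
        linear_combination (dL k x * dK k x) * h
      · simp only [hA, hB, if_false, Finset.mem_union, or_self, Finset.notMem_empty]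
        linear_combination (dK k x * dK k x) * h

theorem hx_sqH_cut (hd : HxD K L dK dL) (A B : Finset ℕ) (k : ℕ) (hAB : Disjoint A B) :
    sqHellinger (hxH K L ∅ k) (hxH K L (A ∪ B) k) =
      sqHellinger (hxH K L A k) (hxH K L B k) := by
  have key : ∀ A B : Finset ℕ, sqHellinger (hxH K L A k) (hxH K L B k) =
      2 - 2 * ∫ x, √(hxg dK dL A k x * hxg dK dL B k x) ∂(hxM K L k) := by
    intro A B
    have := hxM_fin K L k
    have hi : Integrable (fun x => 2 * √(hxg dK dL A k x * hxg dK dL B k x)) (hxM K L k) := by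
      refine Integrable.const_mul (Integrable.of_bound
        ((hxg_meas hd A k).mul (hxg_meas hd B k)).sqrt.aestronglyMeasurable 1 ?_) 2
      filter_upwards with x
      rw [Real.norm_of_nonneg (Real.sqrt_nonneg _)]
      exact Real.sqrt_le_one.2 (mul_le_one₀ (hxg_le_one hd A k x) (hxg_nonneg hd B k x)
        (hxg_le_one hd B k x))
    have hab : Integrable (fun x => hxg dK dL A k x + hxg dK dL B k x) (hxM K L k) :=
      (hxg_integrable hd A k).add (hxg_integrable hd B k)
    rw [hx_sqH_H hd]
    have : ∀ x, (√(hxg dK dL A k x) - √(hxg dK dL B k x)) ^ 2 =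
        hxg dK dL A k x + hxg dK dL B k x - 2 * √(hxg dK dL A k x * hxg dK dL B k x) := by
      intro x
      rw [hx_sqrt_sub_sq (hxg_nonneg hd A k x) (hxg_nonneg hd B k x),
        Real.sqrt_mul (hxg_nonneg hd A k x)]
    simp_rw [this]
    rw [integral_sub hab hi, integral_add (hxg_integrable hd A k) (hxg_integrable hd B k),
      hxg_int hd, hxg_int hd, integral_const_mul]
    norm_num
  rw [key, key]
  simp_rw [hxg_cut A B k _ hAB]

theorem hx_hf (hd : HxD K L dK dL) (n : ℕ) (V : Type) [Fintype V] [DecidableEq V]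
    (A : V → Finset ℕ) (hA : ∀ x y, x ≠ y → Disjoint (A x) (A y)) :
    ∑ x, ∑ y, (if x = y then 0 else sqHellinger (hxH K L ∅ n) (hxH K L (A x ∪ A y) n)) ≤
      2 * (Fintype.card V : ℝ) * ∑ x, sqHellinger (hxH K L ∅ n) (hxH K L (A x) n) := by
  have e1 : ∀ x y, (if x = y then 0 else sqHellinger (hxH K L ∅ n) (hxH K L (A x ∪ A y) n)) =
      ∫ z, (√(hxg dK dL (A x) n z) - √(hxg dK dL (A y) n z)) ^ 2 ∂(hxM K L n) := by
    intro x y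
    split_ifs with h
    · simp [h]
    · rw [hx_sqH_cut hd _ _ _ (hA x y h), hx_sqH_H hd]
  have hi : ∀ A B : Finset ℕ, Integrable
      (fun z => (√(hxg dK dL A n z) - √(hxg dK dL B n z)) ^ 2) (hxM K L n) := fun A B =>
    hx_integrable_sq (hxg_meas hd A n) (hxg_meas hd B n) (hxg_nonneg hd A n) (hxg_nonneg hd B n)
      (hxg_integrable hd A n) (hxg_integrable hd B n)
  simp_rw [e1, hx_sqH_H hd]
  have e2 : ∀ x, ∑ y, ∫ z, (√(hxg dK dL (A x) n z) - √(hxg dK dL (A y) n z)) ^ 2 ∂(hxM K L n) =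
      ∫ z, ∑ y, (√(hxg dK dL (A x) n z) - √(hxg dK dL (A y) n z)) ^ 2 ∂(hxM K L n) := fun x =>
    (integral_finsetSum _ fun y _ => hi _ _).symm
  simp_rw [e2]
  rw [← integral_finsetSum _ (fun x _ => integrable_finsetSum _ fun y _ => hi _ _),
    ← integral_finsetSum _ (fun y _ => hi _ _), ← integral_const_mul]
  refine integral_mono (integrable_finsetSum _ fun x _ => integrable_finsetSum _ fun y _ => hi _ _)
    ((integrable_finsetSum _ fun y _ => hi _ _).const_mul _) fun z => ?_
  exact hx_sum_sq (fun x => √(hxg dK dL (A x) n z)) _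

/-- Integrating out the last coordinate. -/
theorem hx_out {k : ℕ} (κ : Kernel (∀ j : Fin k, 𝒳 j) (𝒳 k)) [IsMarkovKernel κ]
    (d : (∀ j : Fin (k + 1), 𝒳 j) → ℝ) (hdm : Measurable d) (hd0 : ∀ x, 0 ≤ d x)
    (he : hxS κ (hxM K L k) = (hxM K L (k + 1)).withDensity (fun x => ENNReal.ofReal (d x)))
    (φ : (∀ j : Fin k, 𝒳 j) → ℝ) (hφ : Measurable φ) :
    (Integrable φ (hxM K L k) →
      Integrable (fun x => d x * φ (resFun 𝒳 k (Nat.le_succ k) x)) (hxM K L (k + 1))) ∧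
    ∫ x, d x * φ (resFun 𝒳 k (Nat.le_succ k) x) ∂(hxM K L (k + 1)) =
      ∫ x, φ x ∂(hxM K L k) := by
  have := hxM_fin K L k
  have hr : Measurable (resFun 𝒳 (n := k + 1) k (Nat.le_succ k)) := hx_res_meas 𝒳 k _
  constructor
  · intro hi
    rw [← hx_integrable_wd _ d (fun x => φ (resFun 𝒳 k (Nat.le_succ k) x)) hdm hd0, ← he]
    rw [← hxS_res κ (hxM K L k)] at hi
    exact (integrable_map_measure hφ.aestronglyMeasurable hr.aemeasurable).1 hi
  · rw [← hx_integral_wd _ d (fun x => φ (resFun 𝒳 k (Nat.le_succ k) x)) hdm hd0, ← he]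
    conv_rhs => rw [← hxS_res κ (hxM K L k)]
    rw [integral_map hr.aemeasurable hφ.aestronglyMeasurable]

theorem hx_single_step (hd : HxD K L dK dL) (i k : ℕ) (hik : i < k) :
    sqHellinger (hxH K L ∅ (k + 1)) (hxH K L {i} (k + 1)) =
      sqHellinger (hxH K L ∅ k) (hxH K L {i} k) := by
  rw [hx_sqH_H hd, hx_sqH_H hd]
  have hmm : Measurable (fun x => (√(hxg dK dL ∅ k x) - √(hxg dK dL {i} k x)) ^ 2) :=
    ((hxg_meas hd ∅ k).sqrt.sub (hxg_meas hd {i} k).sqrt).pow_const 2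
  rw [← (hx_out (K := K) (L := L) (K k) (dK k) (hd.mK k) (hd.K0 k) (hd.eK k) _ hmm).2]
  refine integral_congr_ae ?_
  filter_upwards with x
  have h : k ∉ ({i} : Finset ℕ) := by simp; omega
  simp only [hxg, h, if_false, Finset.notMem_empty]
  rw [Real.sqrt_mul (hxg_nonneg hd _ _ _), Real.sqrt_mul (hxg_nonneg hd _ _ _), ← sub_mul, mul_pow,
    Real.sq_sqrt (hd.K0 k x), mul_comm]

theorem hx_single_base (i : ℕ) (hm : Measurable fun h => sqHellinger (K i h) (L i h)) :
    sqHellinger (hxH K L ∅ (i + 1)) (hxH K L {i} (i + 1)) ≤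
      ∫ h, sqHellinger (K i h) (L i h) ∂(hxH K L ∅ i) := by
  have := hxH_prob K L ∅ i
  simp only [hxH, Finset.notMem_empty, if_false, Finset.mem_singleton, if_true]
  rw [hxH_congr K L {i} ∅ i (fun j hj => by simp; omega)]
  exact hx_kernel (hxH K L ∅ i) (K i) (L i) hm _ (hx_snoc_meas 𝒳 i)

theorem hx_single (hd : HxD K L dK dL) (i n : ℕ) (hin : i < n)
    (hm : Measurable fun h => sqHellinger (K i h) (L i h)) :
    sqHellinger (hxH K L ∅ n) (hxH K L {i} n) ≤
      ∫ h, sqHellinger (K i h) (L i h) ∂(hxH K L ∅ i) := by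
  induction n, hin using Nat.le_induction with
  | base => exact hx_single_base i hm
  | succ k hk ih => rw [hx_single_step hd i k hk]; exact ih

theorem hx_ae_res (k : ℕ) (p : (∀ j : Fin k, 𝒳 j) → Prop) (h : ∀ᵐ x ∂(hxM K L k), p x) :
    ∀ᵐ x ∂(hxM K L (k + 1)), p (resFun 𝒳 k (Nat.le_succ k) x) := by
  have := hxM_fin K L k
  have hr : Measurable (resFun 𝒳 (n := k + 1) k (Nat.le_succ k)) := hx_res_meas 𝒳 k _
  have e : hxM K L (k + 1) = hxS (K k) (hxM K L k) + hxS (L k) (hxM K L k) := rfl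
  rw [e, ae_add_measure_iff]
  constructor
  · rw [← hxS_res (K k) (hxM K L k)] at h
    exact ae_of_ae_map hr.aemeasurable h
  · rw [← hxS_res (L k) (hxM K L k)] at h
    exact ae_of_ae_map hr.aemeasurable h

theorem hx_ae_bound (hd : HxD K L dK dL) (k : ℕ) (V : ℝ) (hV : 0 ≤ V)
    (h : ∀ (h : ∀ j : Fin k, 𝒳 j) (A : Set (𝒳 k)),
        MeasurableSet A → K k h A ≤ ENNReal.ofReal V * L k h A) :
    ∀ᵐ x ∂(hxM K L (k + 1)), dK k x ≤ V * dL k x := by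
  have := hxM_fin K L k
  have := hxM_fin K L (k + 1)
  have hs := hx_snoc_meas 𝒳 k
  have h1 : (fun x => ENNReal.ofReal (dK k x)) ≤ᵐ[hxM K L (k + 1)]
      (fun x => ENNReal.ofReal (V * dL k x)) := by
    refine ae_le_of_forall_setLIntegral_le_of_sigmaFinite (hd.mK k).ennreal_ofReal ?_
    intro s hs' _
    simp_rw [ENNReal.ofReal_mul hV]
    rw [lintegral_const_mul _ (hd.mL k).ennreal_ofReal, ← withDensity_apply _ hs',
      ← withDensity_apply _ hs', ← hd.eK, ← hd.eL]
    unfold hxS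
    rw [Measure.map_apply hs hs', Measure.map_apply hs hs', Measure.compProd_apply (hs hs'),
      Measure.compProd_apply (hs hs'), ← lintegral_const_mul]
    · exact lintegral_mono fun x => h x _ (measurable_prodMk_left (hs hs'))
    · exact Kernel.measurable_kernel_prodMk_left (hs hs')
  filter_upwards [h1] with x hx
  exact (ENNReal.ofReal_le_ofReal_iff (mul_nonneg hV (hd.L0 k x))).1 hx

theorem hx_log_split {u w a b : ℝ} (h1 : w = 0 → u = 0) (h2 : b = 0 → a = 0) :
    (u * a) * Real.log ((u * a) / (w * b)) =
      a * (u * Real.log (u / w)) + u * (a * Real.log (a / b)) := by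
  by_cases hu : u = 0
  · simp [hu]
  by_cases ha : a = 0
  · simp [ha]
  have hw : w ≠ 0 := fun h => hu (h1 h)
  have hb : b ≠ 0 := fun h => ha (h2 h)
  rw [mul_div_mul_comm, Real.log_mul (div_ne_zero hu hw) (div_ne_zero ha hb)]
  ring

theorem hx_kl_ind (hd : HxD K L dK dL) (n : ℕ) (V : ℝ) (hV : Real.exp 1 ≤ V)
    (hb : ∀ k < n, ∀ᵐ x ∂(hxM K L (k + 1)), dK k x ≤ V * dL k x) (k : ℕ) (hk : k ≤ n) :
    (∀ᵐ x ∂(hxM K L k), hxg dK dL (Finset.range n) k x = 0 → hxg dK dL ∅ k x = 0) ∧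
    Integrable (fun x => hxg dK dL ∅ k x *
      Real.log (hxg dK dL ∅ k x / hxg dK dL (Finset.range n) k x)) (hxM K L k) ∧
    ∫ x, hxg dK dL ∅ k x *
      Real.log (hxg dK dL ∅ k x / hxg dK dL (Finset.range n) k x) ∂(hxM K L k) ≤
      3 * Real.log V * ∑ i ∈ Finset.range k,
        sqHellinger (hxH K L ∅ (i + 1)) (hxH K L {i} (i + 1)) := by
  have hV0 : 0 < V := lt_of_lt_of_le (Real.exp_pos 1) hV
  have hT : 1 ≤ Real.log V := (Real.le_log_iff_exp_le hV0).2 hV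
  induction k with
  | zero => simp [hxg]
  | succ k ih =>
    obtain ⟨i1, i2, i3⟩ := ih (by omega)
    have hkn : k ∈ Finset.range n := Finset.mem_range.2 (by omega)
    have hfin := hxM_fin K L (k + 1)
    have hfin' := hxM_fin K L k
    have hr : Measurable (resFun 𝒳 (n := k + 1) k (Nat.le_succ k)) := hx_res_meas 𝒳 k _
    have hb := hb k (by omega)
    have i1r := hx_ae_res k _ i1
    have g0s : ∀ x, hxg dK dL ∅ (k + 1) x =
        hxg dK dL ∅ k (resFun 𝒳 k (Nat.le_succ k) x) * dK k x := fun x => by simp [hxg]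
    have g1s : ∀ x, hxg dK dL (Finset.range n) (k + 1) x =
        hxg dK dL (Finset.range n) k (resFun 𝒳 k (Nat.le_succ k) x) * dL k x := fun x => by
      simp only [hxg, hkn, if_true]
    have ges : ∀ x, hxg dK dL {k} (k + 1) x =
        hxg dK dL ∅ k (resFun 𝒳 k (Nat.le_succ k) x) * dL k x := fun x => by
      have e : ∀ m ≤ k, ∀ y, hxg dK dL {k} m y = hxg dK dL ∅ m y := by
        intro m
        induction m with
        | zero => intro _ y; rfl
        | succ m ihm =>
          intro hm y
          have : m ∉ ({k} : Finset ℕ) := by simp; omega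
          simp only [hxg, this, if_false, Finset.notMem_empty]
          rw [ihm (by omega)]
      simp [hxg, e k le_rfl]
    have um : Measurable (fun x => hxg dK dL ∅ k (resFun 𝒳 (n := k + 1) k (Nat.le_succ k) x)) :=
      (hxg_meas hd ∅ k).comp hr
    have dd : ∀ᵐ x ∂(hxM K L (k + 1)), dL k x = 0 → dK k x = 0 := by
      filter_upwards [hb] with x hx h0
      rw [h0, mul_zero] at hx
      exact le_antisymm hx (hd.K0 k x)
    have phm : Measurable (fun x => hxg dK dL ∅ k x *
        Real.log (hxg dK dL ∅ k x / hxg dK dL (Finset.range n) k x)) :=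
      (hxg_meas hd ∅ k).mul (Real.measurable_log.comp
        ((hxg_meas hd ∅ k).div (hxg_meas hd (Finset.range n) k)))
    have o1 := hx_out (K := K) (L := L) (K k) (dK k) (hd.mK k) (hd.K0 k) (hd.eK k) _ phm
    have o2 := hx_out (K := K) (L := L) (K k) (dK k) (hd.mK k) (hd.K0 k) (hd.eK k) _
      (hxg_meas hd ∅ k)
    have o3 := hx_out (K := K) (L := L) (L k) (dL k) (hd.mL k) (hd.L0 k) (hd.eL k) _
      (hxg_meas hd ∅ k)
    have hup : ∀ᵐ x ∂(hxM K L (k + 1)), dK k x * Real.log (dK k x / dL k x) ≤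
        dK k x - dL k x + 3 * Real.log V * (√(dK k x) - √(dL k x)) ^ 2 := by
      filter_upwards [hb] with x hx
      refine hx_kl_upper (hd.K0 k x) (hd.L0 k x) hT ?_
      rwa [Real.exp_log hV0]
    have hlo : ∀ᵐ x ∂(hxM K L (k + 1)), (√(dK k x) - √(dL k x)) ^ 2 ≤
        dK k x * Real.log (dK k x / dL k x) + dL k x - dK k x := by
      filter_upwards [dd] with x hx
      exact hx_kl_lower (hd.K0 k x) (hd.L0 k x) hx
    have j2 : Integrable (fun x => hxg dK dL ∅ k (resFun 𝒳 k (Nat.le_succ k) x) *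
        (dK k x * Real.log (dK k x / dL k x))) (hxM K L (k + 1)) := by
      refine Integrable.of_bound (um.mul ((hd.mK k).mul (Real.measurable_log.comp
        ((hd.mK k).div (hd.mL k))))).aestronglyMeasurable (1 + 6 * Real.log V) ?_
      filter_upwards [hup, hlo] with x h1 h2
      have a0 := hd.K0 k x
      have a1 := hd.K1 k x
      have b0 := hd.L0 k x
      have b1 := hd.L1 k x
      have c := hx_sqrt_sub_sq_le a0 b0
      have c0 := sq_nonneg (√(dK k x) - √(dL k x))
      have : |dK k x * Real.log (dK k x / dL k x)| ≤ 1 + 6 * Real.log V := by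
        rw [abs_le]
        constructor
        · nlinarith
        · nlinarith
      rw [Real.norm_eq_abs, abs_mul, abs_of_nonneg (hxg_nonneg hd ∅ k _)]
      calc _ ≤ 1 * |dK k x * Real.log (dK k x / dL k x)| :=
            mul_le_mul_of_nonneg_right (hxg_le_one hd ∅ k _) (abs_nonneg _)
        _ ≤ _ := by rw [one_mul]; exact this
    have hsplit : (fun x => hxg dK dL ∅ (k + 1) x *
        Real.log (hxg dK dL ∅ (k + 1) x / hxg dK dL (Finset.range n) (k + 1) x))
        =ᵐ[hxM K L (k + 1)] fun x =>
        dK k x * (hxg dK dL ∅ k (resFun 𝒳 k (Nat.le_succ k) x) *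
          Real.log (hxg dK dL ∅ k (resFun 𝒳 k (Nat.le_succ k) x) /
            hxg dK dL (Finset.range n) k (resFun 𝒳 k (Nat.le_succ k) x))) +
        hxg dK dL ∅ k (resFun 𝒳 k (Nat.le_succ k) x) *
          (dK k x * Real.log (dK k x / dL k x)) := by
      filter_upwards [i1r, dd] with x h1 h2
      rw [g0s, g1s]
      exact hx_log_split h1 h2
    have j1 := o1.1 i2
    have hq : Integrable (fun x => 3 * Real.log V *
        (√(hxg dK dL ∅ (k + 1) x) - √(hxg dK dL {k} (k + 1) x)) ^ 2) (hxM K L (k + 1)) :=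
      (hx_integrable_sq (hxg_meas hd ∅ _) (hxg_meas hd {k} _) (hxg_nonneg hd ∅ _)
        (hxg_nonneg hd {k} _) (hxg_integrable hd ∅ _) (hxg_integrable hd {k} _)).const_mul _
    have k2 := o2.1 (hxg_integrable hd ∅ k)
    have k3 := o3.1 (hxg_integrable hd ∅ k)
    refine ⟨?_, ?_, ?_⟩
    · filter_upwards [i1r, dd] with x h1 h2 h
      rw [g1s, mul_eq_zero] at h
      rw [g0s, mul_eq_zero]
      exact h.imp h1 h2
    · exact (j1.add j2).congr hsplit.symm
    · rw [integral_congr_ae hsplit, integral_add j1 j2, o1.2, Finset.sum_range_succ, mul_add]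
      refine add_le_add i3 ?_
      rw [hx_sqH_H hd, ← integral_const_mul]
      have k4 : Integrable (fun x => dK k x * hxg dK dL ∅ k (resFun 𝒳 k (Nat.le_succ k) x) -
        dL k x * hxg dK dL ∅ k (resFun 𝒳 k (Nat.le_succ k) x)) (hxM K L (k + 1)) := k2.sub k3
      calc _ ≤ ∫ x, ((dK k x * hxg dK dL ∅ k (resFun 𝒳 k (Nat.le_succ k) x) -
            dL k x * hxg dK dL ∅ k (resFun 𝒳 k (Nat.le_succ k) x)) + 3 * Real.log V *
            (√(hxg dK dL ∅ (k + 1) x) - √(hxg dK dL {k} (k + 1) x)) ^ 2) ∂(hxM K L (k + 1)) := by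
            refine integral_mono_ae j2 (k4.add hq) ?_
            filter_upwards [hup] with x h1
            have u0 := hxg_nonneg hd ∅ k (resFun 𝒳 k (Nat.le_succ k) x)
            rw [g0s, ges, Real.sqrt_mul u0, Real.sqrt_mul u0, ← mul_sub, mul_pow,
              Real.sq_sqrt u0]
            have := mul_le_mul_of_nonneg_left h1 u0
            linarith
        _ = _ := by
            rw [integral_add k4 hq, integral_sub k2 k3, o2.2, o3.2]
            ring

theorem hx_kl_final (hd : HxD K L dK dL) (n : ℕ) (V : ℝ) (hV : Real.exp 1 ≤ V)
    (hb : ∀ k < n, ∀ᵐ x ∂(hxM K L (k + 1)), dK k x ≤ V * dL k x) :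
    sqHellinger (hxH K L ∅ n) (hxH K L (Finset.range n) n) ≤
      3 * Real.log V * ∑ i ∈ Finset.range n,
        sqHellinger (hxH K L ∅ (i + 1)) (hxH K L {i} (i + 1)) := by
  obtain ⟨i1, i2, i3⟩ := hx_kl_ind hd n V hV hb n le_rfl
  refine le_trans ?_ i3
  have a0 := hxg_integrable hd ∅ n
  have a1 := hxg_integrable hd (Finset.range n) n
  have a2 : Integrable (fun x => hxg dK dL ∅ n x *
      Real.log (hxg dK dL ∅ n x / hxg dK dL (Finset.range n) n x) +
      hxg dK dL (Finset.range n) n x) (hxM K L n) := i2.add a1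
  rw [hx_sqH_H hd]
  calc _ ≤ ∫ x, (hxg dK dL ∅ n x *
      Real.log (hxg dK dL ∅ n x / hxg dK dL (Finset.range n) n x) +
      hxg dK dL (Finset.range n) n x - hxg dK dL ∅ n x) ∂(hxM K L n) := by
        refine integral_mono_ae (hx_integrable_sq (hxg_meas hd _ _) (hxg_meas hd _ _)
          (hxg_nonneg hd _ _) (hxg_nonneg hd _ _) a0 a1) (a2.sub a0) ?_
        filter_upwards [i1] with x hx
        exact hx_kl_lower (hxg_nonneg hd _ _ _) (hxg_nonneg hd _ _ _) hx
    _ = _ := by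
        rw [integral_sub a2 a0, integral_add i2 a1, hxg_int hd, hxg_int hd]
        ring

theorem hx_ident (n : ℕ) (A : Finset ℕ) (P : Measure (∀ j : Fin n, 𝒳 j)) [IsProbabilityMeasure P]
    (hP : ∀ k, ∀ hk : k < n, P.map (resFun 𝒳 (k + 1) hk) =
      ((P.map (resFun 𝒳 k hk.le)).compProd (if k ∈ A then L k else K k)).map (snocFun 𝒳 k))
    (k : ℕ) (hk : k ≤ n) : P.map (resFun 𝒳 k hk) = hxH K L A k := by
  induction k with
  | zero =>
    have : IsProbabilityMeasure (P.map (resFun 𝒳 0 hk)) :=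
      Measure.isProbabilityMeasure_map (hx_res_meas 𝒳 0 hk).aemeasurable
    have := hxH_prob K L A 0
    ext s hs
    rcases Set.eq_empty_or_nonempty s with h | ⟨y, hy⟩
    · simp [h]
    · have : s = Set.univ := by
        ext z
        have : z = y := by funext j; exact j.elim0
        simp [this, hy]
      rw [this, measure_univ, measure_univ]
  | succ k ih =>
    rw [hP k hk, ih]
    by_cases h : k ∈ A
    · simp only [hxH, h, if_true, hxS]
    · simp only [hxH, h, if_false, hxS]

end

theorem hellinger_chain_rule (𝒳 : ℕ → Type*) [∀ i, MeasurableSpace (𝒳 i)] (n : ℕ)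
    (K L : (i : ℕ) → Kernel (∀ j : Fin i, 𝒳 j) (𝒳 i))
    [∀ i, IsMarkovKernel (K i)] [∀ i, IsMarkovKernel (L i)]
    (hKL_meas : ∀ i : Fin n,
      Measurable fun h : ∀ j : Fin (i : ℕ), 𝒳 j =>
        sqHellinger (K (i : ℕ) h) (L (i : ℕ) h))
    (P Q : Measure (∀ j : Fin n, 𝒳 j)) [IsProbabilityMeasure P] [IsProbabilityMeasure Q]
    (hP : ∀ k, ∀ hk : k < n, P.map (resFun 𝒳 (k + 1) hk) =
      ((P.map (resFun 𝒳 k hk.le)).compProd (K k)).map (snocFun 𝒳 k))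
    (hQ : ∀ k, ∀ hk : k < n, Q.map (resFun 𝒳 (k + 1) hk) =
      ((Q.map (resFun 𝒳 k hk.le)).compProd (L k)).map (snocFun 𝒳 k)) :
    (2 ≤ n →
      sqHellinger P Q ≤ 100 * Real.log n *
        ∫ x, (∑ i : Fin n, sqHellinger (K (i : ℕ) (resFun 𝒳 (i : ℕ) i.isLt.le x))
          (L (i : ℕ) (resFun 𝒳 (i : ℕ) i.isLt.le x))) ∂P) ∧
    (∀ V : ℝ, Real.exp 1 ≤ V →
      (∀ (i : Fin n) (h : ∀ j : Fin (i : ℕ), 𝒳 j) (A : Set (𝒳 (i : ℕ))),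
        MeasurableSet A → K (i : ℕ) h A ≤ ENNReal.ofReal V * L (i : ℕ) h A) →
      sqHellinger P Q ≤ 3 * Real.log V *
        ∫ x, (∑ i : Fin n, sqHellinger (K (i : ℕ) (resFun 𝒳 (i : ℕ) i.isLt.le x))
          (L (i : ℕ) (resFun 𝒳 (i : ℕ) i.isLt.le x))) ∂P) := by
  obtain ⟨dK, dL, hd⟩ := hxD_exists K L
  have iP := hx_ident (K := K) (L := L) n ∅ P (by simpa using hP)
  have iQ := hx_ident (K := K) (L := L) n (Finset.range n) Q (fun k hk => by
    rw [if_pos (Finset.mem_range.2 hk)]; exact hQ k hk)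
  have eid : resFun 𝒳 (n := n) n le_rfl = id := rfl
  have eP : P = hxH K L ∅ n := by
    have := iP n le_rfl
    rwa [eid, Measure.map_id] at this
  have eQ : Q = hxH K L (Finset.range n) n := by
    have := iQ n le_rfl
    rwa [eid, Measure.map_id] at this
  have hmr : ∀ i : Fin n, Measurable fun x =>
      sqHellinger (K (i : ℕ) (resFun 𝒳 (i : ℕ) i.isLt.le x))
          (L (i : ℕ) (resFun 𝒳 (i : ℕ) i.isLt.le x)) := fun i =>
    (hKL_meas i).comp (hx_res_meas 𝒳 (i : ℕ) i.isLt.le)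
  have hsum : ∫ x, (∑ i : Fin n, sqHellinger (K (i : ℕ) (resFun 𝒳 (i : ℕ) i.isLt.le x))
          (L (i : ℕ) (resFun 𝒳 (i : ℕ) i.isLt.le x))) ∂P =
      ∑ i : Fin n, ∫ h, sqHellinger (K (i : ℕ) h) (L (i : ℕ) h) ∂(hxH K L ∅ (i : ℕ)) := by
    rw [integral_finsetSum]
    · refine Finset.sum_congr rfl fun i _ => ?_
      rw [← iP (i : ℕ) i.isLt.le, integral_map (hx_res_meas 𝒳 (i : ℕ) i.isLt.le).aemeasurable
        (hKL_meas i).aestronglyMeasurable]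
    · intro i _
      refine Integrable.of_bound (hmr i).aestronglyMeasurable 2 ?_
      filter_upwards with x
      rw [Real.norm_of_nonneg (hx_sqH_nonneg _ _)]
      exact hx_sqH_le_two _ _
  rw [hsum]
  constructor
  · intro hn
    have hc := hx_comb_final (fun A => sqHellinger (hxH K L ∅ n) (hxH K L A n))
      (fun A => hx_sqH_nonneg _ _) (by simp [hx_sqH_H hd]) (hx_hf hd n) n hn
    rw [eP, eQ]
    refine hc.trans ?_
    refine mul_le_mul_of_nonneg_left ?_ (mul_nonneg (by norm_num) (Real.log_natCast_nonneg n))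
    exact Finset.sum_le_sum fun i _ => hx_single hd i n i.isLt (hKL_meas i)
  · intro V hV hA
    have hV0 : 0 < V := lt_of_lt_of_le (Real.exp_pos 1) hV
    have hT : 1 ≤ Real.log V := (Real.le_log_iff_exp_le hV0).2 hV
    have hc := hx_kl_final hd n V hV
      (fun k hk => hx_ae_bound hd k V hV0.le (fun h A => hA ⟨k, hk⟩ h A))
    rw [eP, eQ]
    refine hc.trans ?_
    refine mul_le_mul_of_nonneg_left ?_ (by linarith)
    rw [← Fin.sum_univ_eq_sum_range
      (fun i => sqHellinger (hxH K L ∅ (i + 1)) (hxH K L {i} (i + 1))) n]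
    exact Finset.sum_le_sum fun i _ => hx_single_base (i : ℕ) (hKL_meas i)
end
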